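/- arXiv:1803.05763 — 6 statements merged into one kernel-verified Lean document; each statement's English description precedes it below -/
import Mathlib

section
/- (Minkowski determinant inequality) Let A and B be positive semidefinite Hermitian n×n complex matrices with n ≥ 1. Then the determinants of A, B and A+B are nonnegative real numbers and ((A+B).det.re)^(1/n) ≥ (A.det.re)^(1/n) + (B.det.re)^(1/n), where x^(1/n) denotes the real power Real.rpow x (1/n). -/
open Matrix ComplexOrder

open scoped MatrixOrder in
/-- A positive definite matrix is congruent to the identity. -/
theorem Matrix.PosDef.exists_conjTranspose_mul_mul_eq_one {ι : Type*} [Fintype ι] [DecidableEq ι]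
    {S : Matrix ι ι ℂ} (hS : S.PosDef) : ∃ Y : Matrix ι ι ℂ, Yᴴ * S * Y = 1 := by
  obtain ⟨X, rfl⟩ := CStarAlgebra.nonneg_iff_eq_star_mul_self.mp hS.posSemidef.nonneg
  have hX : IsUnit X.det := by
    have h := (isUnit_iff_isUnit_det _).mp hS.isUnit
    rw [det_mul] at h
    exact isUnit_of_mul_isUnit_right h
  refine ⟨X⁻¹, ?_⟩
  rw [star_eq_conjTranspose, ← Matrix.mul_assoc, ← conjTranspose_mul, mul_nonsing_inv _ hX,
    conjTranspose_one, Matrix.one_mul, mul_nonsing_inv _ hX]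

theorem Matrix.PosSemidef.re_det_nonneg {ι : Type*} [Fintype ι] [DecidableEq ι]
    {A : Matrix ι ι ℂ} (hA : A.PosSemidef) : 0 ≤ A.det.re :=
  (Complex.le_def.mp hA.det_nonneg).1

/-- The arithmetic-geometric mean inequality for the eigenvalues of a positive semidefinite
matrix. -/
theorem Matrix.PosSemidef.re_det_rpow_le_re_trace_div {ι : Type*} [Fintype ι] [DecidableEq ι]
    [Nonempty ι] {A : Matrix ι ι ℂ} (hA : A.PosSemidef) :
    A.det.re ^ ((1 : ℝ) / Fintype.card ι) ≤ A.trace.re / Fintype.card ι := by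
  have h := Real.geom_mean_le_arith_mean Finset.univ (fun _ => 1) hA.1.eigenvalues
    (by simp) (by simp [Fintype.card_pos]) (fun i _ => hA.eigenvalues_nonneg i)
  have hdet : A.det.re = ∏ i, hA.1.eigenvalues i := by
    rw [hA.1.det_eq_prod_eigenvalues]
    exact congrArg Complex.re (Complex.ofReal_prod Finset.univ hA.1.eigenvalues).symm
  have htrace : A.trace.re = ∑ i, hA.1.eigenvalues i := by
    rw [hA.1.trace_eq_sum_eigenvalues]
    exact congrArg Complex.re (Complex.ofReal_sum Finset.univ hA.1.eigenvalues).symm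
  simpa [hdet, htrace] using h

theorem Matrix.PosSemidef.re_det_rpow_add_le_one {ι : Type*} [Fintype ι] [DecidableEq ι]
    [Nonempty ι] {A B : Matrix ι ι ℂ} (hA : A.PosSemidef) (hB : B.PosSemidef) (h : A + B = 1) :
    A.det.re ^ ((1 : ℝ) / Fintype.card ι) + B.det.re ^ ((1 : ℝ) / Fintype.card ι) ≤ 1 := by
  refine (add_le_add hA.re_det_rpow_le_re_trace_div hB.re_det_rpow_le_re_trace_div).trans_eq ?_
  rw [← add_div, ← Complex.add_re, ← trace_add, h, trace_one]
  simp

/-- The Minkowski determinant inequality over an arbitrary nonempty finite index type. -/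
theorem Matrix.PosSemidef.re_det_rpow_add_le {ι : Type*} [Fintype ι] [DecidableEq ι]
    [Nonempty ι] {A B : Matrix ι ι ℂ} (hA : A.PosSemidef) (hB : B.PosSemidef) :
    A.det.re ^ ((1 : ℝ) / Fintype.card ι) + B.det.re ^ ((1 : ℝ) / Fintype.card ι)
      ≤ (A + B).det.re ^ ((1 : ℝ) / Fintype.card ι) := by
  by_cases hS : (A + B).PosDef
  · obtain ⟨Y, hY⟩ := hS.exists_conjTranspose_mul_mul_eq_one
    have hdetY : Yᴴ.det * (A + B).det * Y.det = 1 := by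
      rw [← det_mul, ← det_mul, hY, det_one]
    have hSre : ((A + B).det.re : ℂ) = (A + B).det :=
      (Complex.eq_re_of_ofReal_le (r := 0) (by simpa using hS.posSemidef.det_nonneg)).symm
    have hconj (M : Matrix ι ι ℂ) : M.det.re = (A + B).det.re * (Yᴴ * M * Y).det.re := by
      rw [← Complex.re_ofReal_mul, hSre, det_mul, det_mul]
      congr 1
      linear_combination -M.det * hdetY
    have hAY := hA.conjTranspose_mul_mul_same Y
    have hBY := hB.conjTranspose_mul_mul_same Y
    have h := hAY.re_det_rpow_add_le_one hBY (by rw [← Matrix.add_mul, ← Matrix.mul_add, hY])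
    have hpos := hS.posSemidef.re_det_nonneg
    rw [hconj A, hconj B, Real.mul_rpow hpos hAY.re_det_nonneg,
      Real.mul_rpow hpos hBY.re_det_nonneg, ← mul_add]
    exact mul_le_of_le_one_right (Real.rpow_nonneg hpos _) h
  · have hA0 : A.det = 0 := by
      by_contra h
      exact hS ((hA.posDef_iff_det_ne_zero.mpr h).add_posSemidef hB)
    have hB0 : B.det = 0 := by
      by_contra h
      exact hS ((hB.posDef_iff_det_ne_zero.mpr h).posSemidef_add hA)
    have hι : (1 : ℝ) / Fintype.card ι ≠ 0 := by simp
    rw [hA0, hB0, Complex.zero_re, Real.zero_rpow hι, add_zero]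
    exact Real.rpow_nonneg (hA.add hB).re_det_nonneg _

/-- Minkowski determinant inequality for PSD Hermitian complex matrices. -/
theorem stmt_1 (n : ℕ) (hn : 1 ≤ n) (A B : Matrix (Fin n) (Fin n) ℂ)
    (hA : A.PosSemidef) (hB : B.PosSemidef) :
    0 ≤ A.det.re ∧ 0 ≤ B.det.re ∧ 0 ≤ (A + B).det.re ∧
      (A.det.re) ^ ((1 : ℝ) / n) + (B.det.re) ^ ((1 : ℝ) / n)
        ≤ ((A + B).det.re) ^ ((1 : ℝ) / n) := by
  have : Nonempty (Fin n) := ⟨⟨0, hn⟩⟩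
  refine ⟨hA.re_det_nonneg, hB.re_det_nonneg, (hA.add hB).re_det_nonneg, ?_⟩
  simpa only [Fintype.card_fin] using hA.re_det_rpow_add_le hB
end

section
/- Let Σ1 and Σ2 be positive semidefinite Hermitian K×K complex matrices with K ≥ 1 and let q ≥ 0 be real. Then det(I_K + q • (Σ1 * Σ2)) is a nonnegative real number (its imaginary part is zero), and its real part satisfies (det(I_K + q • (Σ1 * Σ2))).re ≥ (1 + q * ((Σ1.det.re * Σ2.det.re)^(1/K)))^K, where x^(1/K) denotes the real power Real.rpow x (1/K). -/
open Matrix ComplexOrder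

/-- Superadditivity of the geometric mean: `(1 + (∏ xᵢ)^{1/n})^n ≤ ∏ (1 + xᵢ)`. -/
theorem Real.one_add_geom_mean_pow_le_prod {ι : Type*} [Fintype ι] [Nonempty ι] (x : ι → ℝ)
    (hx : ∀ i, 0 ≤ x i) :
    (1 + (∏ i, x i) ^ ((1 : ℝ) / Fintype.card ι)) ^ Fintype.card ι ≤ ∏ i, (1 + x i) := by
  have hn : (Fintype.card ι : ℝ) ≠ 0 := Nat.cast_ne_zero.mpr Fintype.card_ne_zero
  have hx1 (i : ι) : 0 < 1 + x i := by linarith [hx i]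
  have amgm (z : ι → ℝ) (hz : ∀ i, 0 ≤ z i) :
      (∏ i, z i) ^ ((1 : ℝ) / Fintype.card ι) ≤ ∑ i, 1 / Fintype.card ι * z i := by
    rw [← Real.finsetProd_rpow _ _ fun i _ => hz i]
    exact Real.geom_mean_le_arith_mean_weighted _ _ z (fun _ _ => by positivity)
      (by simp [hn]) fun i _ => hz i
  have hA := amgm (fun i => 1 / (1 + x i)) fun i => (one_div_pos.mpr (hx1 i)).le
  have hB := amgm (fun i => x i / (1 + x i)) fun i => div_nonneg (hx i) (hx1 i).le
  have hP : 0 < ∏ i, (1 + x i) := Finset.prod_pos fun i _ => hx1 i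
  have hsum : ∑ i, 1 / (Fintype.card ι : ℝ) * (1 / (1 + x i)) +
      ∑ i, 1 / (Fintype.card ι : ℝ) * (x i / (1 + x i)) = 1 := by
    simp_rw [← Finset.sum_add_distrib, ← mul_add, ← add_div, div_self (hx1 _).ne']
    simp [hn]
  rw [Finset.prod_div_distrib, Real.div_rpow (by simp) hP.le] at hA
  rw [Finset.prod_div_distrib, Real.div_rpow (Finset.prod_nonneg fun i _ => hx i) hP.le] at hB
  simp only [Finset.prod_const_one, Real.one_rpow] at hA
  have hle := (add_le_add hA hB).trans_eq hsum
  rw [← add_div, div_le_one (Real.rpow_pos_of_pos hP _)] at hle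
  refine (pow_le_pow_left₀ (add_nonneg zero_le_one
    (Real.rpow_nonneg (Finset.prod_nonneg fun i _ => hx i) _)) hle _).trans_eq ?_
  rw [one_div, Real.rpow_inv_natCast_pow hP.le Fintype.card_ne_zero]

theorem Matrix.IsHermitian.det_one_add_smul_eq_prod {n : Type*} [Fintype n] [DecidableEq n]
    {P : Matrix n n ℂ} (hP : P.IsHermitian) (q : ℝ) :
    (1 + (q : ℂ) • P).det = ((∏ i, (1 + q * hP.eigenvalues i) : ℝ) : ℂ) := by
  conv_lhs => rw [hP.spectral_theorem, Unitary.conjStarAlgAut_apply, mul_assoc, ← mul_smul_comm,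
    det_one_add_mul_comm, smul_mul_assoc, mul_assoc, Unitary.coe_star_mul_self, mul_one,
    ← diagonal_smul, ← diagonal_one, diagonal_add, det_diagonal]
  simp

open scoped MatrixOrder in
theorem Matrix.PosSemidef.exists_eq_conjTranspose_mul_self {n : Type*} [Fintype n] [DecidableEq n]
    {S : Matrix n n ℂ} (hS : S.PosSemidef) : ∃ B : Matrix n n ℂ, S = Bᴴ * B :=
  CStarAlgebra.nonneg_iff_eq_star_mul_self.mp hS.nonneg

/-- pointwise lower bound
`det(I + q Σ1 Σ2).re ≥ (1 + q (det Σ1 · det Σ2)^{1/K})^K` for PSD `Σ1, Σ2`. -/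
theorem stmt_2 (K : ℕ) (hK : 1 ≤ K) (S1 S2 : Matrix (Fin K) (Fin K) ℂ)
    (h1 : S1.PosSemidef) (h2 : S2.PosSemidef) (q : ℝ) (hq : 0 ≤ q) :
    ((1 + (q : ℂ) • (S1 * S2)).det).im = 0 ∧
    0 ≤ ((1 + (q : ℂ) • (S1 * S2)).det).re ∧
    (1 + q * ((S1.det.re * S2.det.re) ^ ((1 : ℝ) / K))) ^ K
      ≤ ((1 + (q : ℂ) • (S1 * S2)).det).re := by
  have : Nonempty (Fin K) := ⟨⟨0, hK⟩⟩
  obtain ⟨B, rfl⟩ := h1.exists_eq_conjTranspose_mul_self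
  have hP : (B * S2 * Bᴴ).PosSemidef := h2.mul_mul_conjTranspose_same B
  have hev := hP.eigenvalues_nonneg
  have hdet : (1 + (q : ℂ) • (Bᴴ * B * S2)).det =
      ((∏ i, (1 + q * hP.isHermitian.eigenvalues i) : ℝ) : ℂ) := by
    rw [← hP.isHermitian.det_one_add_smul_eq_prod, mul_assoc, ← mul_smul_comm,
      det_one_add_mul_comm, smul_mul_assoc]
  have hprod : (Bᴴ * B).det.re * S2.det.re = ∏ i, hP.isHermitian.eigenvalues i := by
    have him : (Bᴴ * B).det.im = 0 := (Complex.nonneg_iff.mp h1.det_nonneg).2.symm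
    have h := hP.isHermitian.det_eq_prod_eigenvalues
    rw [det_mul, det_mul, mul_right_comm, mul_comm B.det, ← det_mul] at h
    have hre := congrArg Complex.re
      (h.trans (Complex.ofReal_prod _ hP.isHermitian.eigenvalues).symm)
    simpa only [Complex.mul_re, him, zero_mul, sub_zero, Complex.ofReal_re] using hre
  rw [hdet, hprod, Complex.ofReal_im, Complex.ofReal_re]
  refine ⟨rfl, Finset.prod_nonneg fun i _ => add_nonneg zero_le_one (mul_nonneg hq (hev i)), ?_⟩
  have h := Real.one_add_geom_mean_pow_le_prod (fun i => q * hP.isHermitian.eigenvalues i)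
    fun i => mul_nonneg hq (hev i)
  rw [Finset.prod_mul_distrib, Finset.prod_const, Finset.card_univ,
    Real.mul_rpow (pow_nonneg hq _) (Finset.prod_nonneg fun i _ => hev i), one_div,
    Real.pow_rpow_inv_natCast hq Fintype.card_ne_zero, ← one_div] at h
  simpa only [Fintype.card_fin] using h
end

section
/- (Concavity of log-determinant) Let A and B be positive definite Hermitian n×n complex matrices and let t ∈ [0,1]. Then Real.log ((t • A + (1 - t) • B).det.re) ≥ t * Real.log (A.det.re) + (1 - t) * Real.log (B.det.re). -/
open Matrix ComplexOrder

open scoped MatrixOrder in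
/-- Two positive definite matrices are simultaneously diagonalized by a congruence, which can be
chosen to take the second one to the identity. -/
theorem Matrix.PosDef.exists_eq_conjTranspose_mul_diagonal_mul {ι : Type*} [Fintype ι]
    [DecidableEq ι] {A B : Matrix ι ι ℂ} (hA : A.PosDef) (hB : B.PosDef) :
    ∃ (P : Matrix ι ι ℂ) (d : ι → ℝ), IsUnit P ∧ (∀ i, 0 < d i) ∧
      A = Pᴴ * diagonal (fun i ↦ (d i : ℂ)) * P ∧ B = Pᴴ * P := by
  obtain ⟨S, hS⟩ := CStarAlgebra.nonneg_iff_eq_star_mul_self.mp hB.posSemidef.nonneg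
  have hSu : IsUnit S := isUnit_of_mul_isUnit_right (hS ▸ hB.isUnit)
  lift S to (Matrix ι ι ℂ)ˣ using hSu
  have hM : (star (↑S⁻¹ : Matrix ι ι ℂ) * A * (↑S⁻¹ : Matrix ι ι ℂ)).PosDef :=
    (IsUnit.posDef_star_left_conjugate_iff S⁻¹.isUnit).2 hA
  set U := hM.isHermitian.eigenvectorUnitary
  have hspec := hM.isHermitian.spectral_theorem
  have hd : (RCLike.ofReal ∘ hM.isHermitian.eigenvalues : ι → ℂ) =
      fun i ↦ (hM.isHermitian.eigenvalues i : ℂ) := rfl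
  rw [Unitary.conjStarAlgAut_apply, hd] at hspec
  refine ⟨star (U : Matrix ι ι ℂ) * (S : Matrix ι ι ℂ), hM.isHermitian.eigenvalues,
    (Unitary.toUnits (star U)).isUnit.mul S.isUnit, hM.eigenvalues_pos, ?_, ?_⟩
  · calc A = star (↑(S⁻¹ * S) : Matrix ι ι ℂ) * A * (↑(S⁻¹ * S) : Matrix ι ι ℂ) := by simp
      _ = star (S : Matrix ι ι ℂ) * (star (↑S⁻¹ : Matrix ι ι ℂ) * A * (↑S⁻¹ : Matrix ι ι ℂ)) *
          (S : Matrix ι ι ℂ) := by simp only [Units.val_mul, star_mul, mul_assoc]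
      _ = _ := by
        refine (congrArg (fun X ↦ star (S : Matrix ι ι ℂ) * X * (S : Matrix ι ι ℂ)) hspec).trans ?_
        rw [← star_eq_conjTranspose, star_mul, star_star]
        simp only [mul_assoc, U]
  · rw [hS, ← star_eq_conjTranspose, star_mul, star_star, mul_assoc, ← mul_assoc (U : Matrix ι ι ℂ),
      Unitary.mul_star_self_of_mem U.2, one_mul]

/-- The determinant of a real combination of two matrices diagonalized by the same congruence. -/
theorem Matrix.re_det_smul_conjTranspose_mul_diagonal_mul_add {ι : Type*} [Fintype ι]
    [DecidableEq ι] (P : Matrix ι ι ℂ) (d : ι → ℝ) (a b : ℝ) :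
    ((a : ℂ) • (Pᴴ * diagonal (fun i ↦ (d i : ℂ)) * P) + (b : ℂ) • (Pᴴ * P)).det.re =
      Complex.normSq P.det * ∏ i, (a * d i + b) := by
  have h : (a : ℂ) • (Pᴴ * diagonal (fun i ↦ (d i : ℂ)) * P) + (b : ℂ) • (Pᴴ * P) =
      Pᴴ * diagonal (fun i ↦ ((a * d i + b : ℝ) : ℂ)) * P := by
    have hd : diagonal (fun i ↦ ((a * d i + b : ℝ) : ℂ)) =
        (a : ℂ) • diagonal (fun i ↦ (d i : ℂ)) + (b : ℂ) • (1 : Matrix ι ι ℂ) := by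
      ext i j
      by_cases hij : i = j <;> simp [hij]
    rw [hd, mul_add, add_mul, Matrix.mul_smul, Matrix.smul_mul, Matrix.mul_smul, Matrix.smul_mul,
      Matrix.mul_one]
  rw [h, det_mul, det_mul, det_diagonal, det_conjTranspose, mul_right_comm, Complex.star_def,
    ← Complex.normSq_eq_conj_mul_self, ← Complex.ofReal_prod, ← Complex.ofReal_mul,
    Complex.ofReal_re]

/-- concavity of log-determinant on positive definite Hermitian matrices. -/
theorem stmt_4 (n : ℕ) (A B : Matrix (Fin n) (Fin n) ℂ)
    (hA : A.PosDef) (hB : B.PosDef) (t : ℝ) (ht0 : 0 ≤ t) (ht1 : t ≤ 1) :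
    t * Real.log A.det.re + (1 - t) * Real.log B.det.re
      ≤ Real.log (((t : ℂ) • A + ((1 - t : ℝ) : ℂ) • B).det.re) := by
  obtain ⟨P, d, hP, hd, rfl, rfl⟩ := hA.exists_eq_conjTranspose_mul_diagonal_mul hB
  have hdet : Complex.normSq P.det ≠ 0 := by
    simpa using ((isUnit_iff_isUnit_det P).1 hP).ne_zero
  have hpos (i : Fin n) : 0 < t * d i + (1 - t) := by
    rcases ht0.eq_or_lt with rfl | ht
    · simp
    · exact add_pos_of_pos_of_nonneg (mul_pos ht (hd i)) (sub_nonneg.2 ht1)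
  have hdetA := re_det_smul_conjTranspose_mul_diagonal_mul_add P d 1 0
  have hdetB := re_det_smul_conjTranspose_mul_diagonal_mul_add P d 0 1
  simp only [Complex.ofReal_one, Complex.ofReal_zero, one_smul, zero_smul, add_zero, zero_add,
    one_mul, zero_mul, Finset.prod_const_one, mul_one] at hdetA hdetB
  have hlog (i : Fin n) : t * Real.log (d i) ≤ Real.log (t * d i + (1 - t)) := by
    simpa using strictConcaveOn_log_Ioi.concaveOn.2 (Set.mem_Ioi.2 (hd i))
      (Set.mem_Ioi.2 one_pos) ht0 (sub_nonneg.2 ht1) (add_sub_cancel t 1)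
  rw [re_det_smul_conjTranspose_mul_diagonal_mul_add, hdetA, hdetB,
    Real.log_mul hdet (Finset.prod_ne_zero_iff.2 fun i _ ↦ (hd i).ne'),
    Real.log_mul hdet (Finset.prod_ne_zero_iff.2 fun i _ ↦ (hpos i).ne'),
    Real.log_prod fun i _ ↦ (hd i).ne', Real.log_prod fun i _ ↦ (hpos i).ne']
  have hsum := Finset.sum_le_sum fun i (_ : i ∈ Finset.univ) ↦ hlog i
  rw [← Finset.mul_sum] at hsum
  linarith
end

section
/- Let μ_ℂ be the standard complex Gaussian measure on ℂ, i.e., the pushforward of the product measure (gaussianReal 0 (1/2)) ×ₘ (gaussianReal 0 (1/2)) under the map (x, y) ↦ x + y*I, and for natural numbers m, n let μ_{m×n} be the product measure (Measure.pi) on Matrix (Fin m) (Fin n) ℂ whose entries are i.i.d. with law μ_ℂ. Then for every natural number K and every unitary K×K complex matrix U, the pushforward of μ_{N×K} under the map Q ↦ Q * U equals μ_{N×K}. -/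
open MeasureTheory ProbabilityTheory Matrix

/-- The standard (circularly symmetric, unit-variance) complex Gaussian measure on `ℂ`:
the pushforward of `gaussianReal 0 (1/2) ×ₘ gaussianReal 0 (1/2)` under `(x, y) ↦ x + y i`. -/
noncomputable def stdComplexGaussian : Measure ℂ :=
  ((gaussianReal 0 (1 / 2)).prod (gaussianReal 0 (1 / 2))).map
    (fun p : ℝ × ℝ => (p.1 : ℂ) + p.2 * Complex.I)

/-- The law of an `m × n` complex matrix with i.i.d. standard complex Gaussian entries
(as a measure on the function type underlying `Matrix (Fin m) (Fin n) ℂ`). -/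
noncomputable def matGaussian (m n : ℕ) : Measure (Fin m → Fin n → ℂ) :=
  Measure.pi fun _ : Fin m => Measure.pi fun _ : Fin n => stdComplexGaussian

instance isProbabilityMeasure_stdComplexGaussian : IsProbabilityMeasure stdComplexGaussian := by
  unfold stdComplexGaussian
  exact Measure.isProbabilityMeasure_map (by fun_prop)

lemma charFun_stdComplexGaussian (z : ℂ) :
    charFun stdComplexGaussian z = Complex.exp (-(z * star z) / 4) := by
  have h : charFun stdComplexGaussian z =
      charFun (gaussianReal 0 (1 / 2)) z.re * charFun (gaussianReal 0 (1 / 2)) z.im := by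
    simp_rw [stdComplexGaussian, charFun_apply]
    rw [integral_map (by fun_prop) (by fun_prop), ← integral_prod_mul]
    congr with p
    rw [← Complex.exp_add]
    congr 1
    simp [Complex.inner]
    ring
  rw [h, charFun_gaussianReal, charFun_gaussianReal, ← Complex.exp_add]
  congr 1
  apply Complex.ext <;> simp [← Complex.ofReal_pow] <;> ring

/-- The real inner product on `ℂⁿ` is the real part of the sesquilinear one. -/
lemma inner_toLp_real_eq_re_dotProduct {ι : Type*} [Fintype ι] (x y : ι → ℂ) :
    inner ℝ (WithLp.toLp 2 x : PiLp 2 fun _ : ι => ℂ) (WithLp.toLp 2 y) = (y ⬝ᵥ star x).re := by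
  simp [PiLp.inner_apply, Complex.inner, dotProduct]

lemma charFun_pi_stdComplexGaussian {ι : Type*} [Fintype ι] (t : ι → ℂ) :
    charFun ((Measure.pi fun _ : ι => stdComplexGaussian).map (WithLp.toLp 2))
      (WithLp.toLp 2 t) = Complex.exp (-(t ⬝ᵥ star t) / 4) := by
  rw [charFun_pi]
  simp_rw [charFun_stdComplexGaussian, ← Complex.exp_sum, dotProduct, ← Finset.sum_div,
    Finset.sum_neg_distrib, Pi.star_apply]

/-- A vector of i.i.d. standard complex Gaussians is invariant in law under unitaries. -/
lemma map_vecMul_pi_stdComplexGaussian {ι : Type*} [Fintype ι] [DecidableEq ι]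
    {U : Matrix ι ι ℂ} (hU : Uᴴ * U = 1) :
    (Measure.pi fun _ : ι => stdComplexGaussian).map (fun x => x ᵥ* U) =
      Measure.pi fun _ : ι => stdComplexGaussian := by
  have hm : Measurable fun x : ι → ℂ => x ᵥ* U := by
    unfold vecMul dotProduct
    fun_prop
  have := Measure.isProbabilityMeasure_map (μ := Measure.pi fun _ : ι => stdComplexGaussian)
    hm.aemeasurable
  refine charFun_eq_pi_iff.1 fun t => ?_
  have hL : charFun (((Measure.pi fun _ : ι => stdComplexGaussian).map
        (fun x => x ᵥ* U)).map (WithLp.toLp 2)) t =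
      charFun ((Measure.pi fun _ : ι => stdComplexGaussian).map (WithLp.toLp 2))
        (WithLp.toLp 2 (t.ofLp ᵥ* Uᴴ)) := by
    rw [Measure.map_map (by fun_prop) hm, charFun_apply, charFun_apply,
      integral_map (by fun_prop) (by fun_prop), integral_map (by fun_prop) (by fun_prop)]
    congr with x
    rw [Function.comp_apply, ← WithLp.toLp_ofLp 2 t, inner_toLp_real_eq_re_dotProduct,
      inner_toLp_real_eq_re_dotProduct, star_vecMul, dotProduct_mulVec]
  rw [hL, ← charFun_pi, charFun_pi_stdComplexGaussian, ← WithLp.toLp_ofLp 2 t,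
    charFun_pi_stdComplexGaussian, star_vecMul, conjTranspose_conjTranspose, dotProduct_mulVec,
    vecMul_vecMul, hU, vecMul_one]

/-- right-rotational invariance of the i.i.d. complex Gaussian matrix ensemble:
for a unitary `K × K` matrix `U`, the law of `Q * U` equals the law of `Q` when
`Q` is `N × K` with i.i.d. standard complex Gaussian entries. -/
theorem stmt_8 (N K : ℕ) (U : Matrix (Fin K) (Fin K) ℂ) (hU : Uᴴ * U = 1) :
    (matGaussian N K).map (fun Q => Matrix.of.symm (Matrix.of Q * U)) = matGaussian N K := by
  have hm : Measurable fun x : Fin K → ℂ => x ᵥ* U := by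
    unfold vecMul dotProduct
    fun_prop
  have hrow := map_vecMul_pi_stdComplexGaussian hU
  have : IsProbabilityMeasure ((Measure.pi fun _ : Fin K => stdComplexGaussian).map
      fun x => x ᵥ* U) := Measure.isProbabilityMeasure_map hm.aemeasurable
  have h := Measure.pi_map_pi (μ := fun _ : Fin N => Measure.pi fun _ : Fin K =>
    stdComplexGaussian) (f := fun _ x => x ᵥ* U) fun _ => hm.aemeasurable
  rw [hrow] at h
  exact h
end

section
/- Let μ_ℂ be the standard complex Gaussian measure on ℂ, i.e., the pushforward of the product measure (gaussianReal 0 (1/2)) ×ₘ (gaussianReal 0 (1/2)) under the map (x, y) ↦ x + y*I, and for natural numbers m, n let μ_{m×n} be the product measure (Measure.pi) on Matrix (Fin m) (Fin n) ℂ whose entries are i.i.d. with law μ_ℂ. Then for all natural numbers M, N ≥ 1 and every real p ≥ 0, ∫ Real.log ((1 + p • (Hᴴ * H)).det.re) ∂μ_{N×M}(H) ≤ M * Real.log (1 + p * N). -/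
open MeasureTheory ProbabilityTheory Matrix

open scoped ComplexOrder in
theorem Matrix.PosDef.log_re_det_le {n : Type*} [Fintype n] [DecidableEq n]
    {A : Matrix n n ℂ} (hA : A.PosDef) {c : ℝ} (hc : 0 < c) :
    Real.log A.det.re ≤ Fintype.card n * Real.log c + (A.trace.re / c - Fintype.card n) := by
  have hdet : A.det.re = ∏ i, hA.isHermitian.eigenvalues i := by
    rw [hA.isHermitian.det_eq_prod_eigenvalues, ← RCLike.ofReal_prod]
    exact Complex.ofReal_re _
  have htrace : A.trace.re = ∑ i, hA.isHermitian.eigenvalues i := by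
    rw [hA.isHermitian.trace_eq_sum_eigenvalues, ← RCLike.ofReal_sum]
    exact Complex.ofReal_re _
  rw [hdet, htrace, Real.log_prod fun i _ => (hA.eigenvalues_pos i).ne', Finset.sum_div]
  calc ∑ i, Real.log (hA.isHermitian.eigenvalues i)
      ≤ ∑ i, (Real.log c + (hA.isHermitian.eigenvalues i / c - 1)) := by
        refine Finset.sum_le_sum fun i _ => ?_
        have h := Real.log_le_sub_one_of_pos (div_pos (hA.eigenvalues_pos i) hc)
        rw [Real.log_div (hA.eigenvalues_pos i).ne' hc.ne'] at h
        linarith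
    _ = _ := by simp [Finset.sum_add_distrib, Finset.sum_sub_distrib]

open scoped ComplexOrder in
theorem posDef_one_add_smul_conjTranspose_mul_self {m n : Type*} [Fintype m] [Fintype n]
    [DecidableEq n] (H : Matrix m n ℂ) {p : ℝ} (hp : 0 ≤ p) :
    (1 + (p : ℂ) • (Hᴴ * H)).PosDef :=
  PosDef.one.add_posSemidef
    ((posSemidef_conjTranspose_mul_self H).smul (Complex.zero_le_real.mpr hp))

theorem re_trace_one_add_smul_conjTranspose_mul_self {m n : Type*} [Fintype m] [Fintype n]
    [DecidableEq n] (H : Matrix m n ℂ) (p : ℝ) :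
    (1 + (p : ℂ) • (Hᴴ * H)).trace.re
      = Fintype.card n + p * ∑ i, ∑ j, Complex.normSq (H i j) := by
  rw [Finset.sum_comm]
  simp [Matrix.trace, Matrix.mul_apply, Finset.sum_add_distrib, Finset.mul_sum, mul_add,
    Complex.normSq_apply]

instance : IsProbabilityMeasure stdComplexGaussian :=
  Measure.isProbabilityMeasure_map (by fun_prop)

instance (m n : ℕ) : IsProbabilityMeasure (matGaussian m n) := by
  unfold matGaussian
  infer_instance

theorem integrable_sq_gaussianReal (μ : ℝ) (v : NNReal) :
    Integrable (fun x : ℝ => x ^ 2) (gaussianReal μ v) :=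
  (memLp_id_gaussianReal 2).integrable_sq

theorem integral_sq_gaussianReal_zero (v : NNReal) :
    ∫ x, x ^ 2 ∂gaussianReal 0 v = v := by
  rw [← variance_of_integral_eq_zero (X := fun x : ℝ => x) aemeasurable_id
    integral_id_gaussianReal, variance_fun_id_gaussianReal]

theorem integrable_normSq_stdComplexGaussian :
    Integrable Complex.normSq stdComplexGaussian := by
  rw [stdComplexGaussian, integrable_map_measure (by fun_prop) (by fun_prop)]
  have h := integrable_sq_gaussianReal 0 (1 / 2)
  refine ((h.comp_fst (gaussianReal 0 (1 / 2))).add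
    (h.comp_snd (gaussianReal 0 (1 / 2)))).congr (.of_forall fun x => ?_)
  simp [Complex.normSq_add_mul_I]

theorem integral_normSq_stdComplexGaussian :
    ∫ z, Complex.normSq z ∂stdComplexGaussian = 1 := by
  rw [stdComplexGaussian, integral_map (by fun_prop) (by fun_prop)]
  have h := integrable_sq_gaussianReal 0 (1 / 2)
  simp only [Complex.normSq_add_mul_I]
  rw [integral_add (h.comp_fst _) (h.comp_snd _),
    integral_fun_fst (fun x : ℝ => x ^ 2), integral_fun_snd (fun x : ℝ => x ^ 2),
    integral_sq_gaussianReal_zero]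
  norm_num

theorem measurePreserving_entry_matGaussian (m n : ℕ) (i : Fin m) (j : Fin n) :
    MeasurePreserving (fun Q : Fin m → Fin n → ℂ => Q i j) (matGaussian m n)
      stdComplexGaussian :=
  (measurePreserving_eval (fun _ : Fin n => stdComplexGaussian) j).comp
    (measurePreserving_eval
      (fun _ : Fin m => Measure.pi fun _ : Fin n => stdComplexGaussian) i)

theorem integrable_normSq_entry_matGaussian (m n : ℕ) (i : Fin m) (j : Fin n) :
    Integrable (fun Q => Complex.normSq (Q i j)) (matGaussian m n) :=
  (measurePreserving_entry_matGaussian m n i j).integrable_comp_of_integrable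
    integrable_normSq_stdComplexGaussian

theorem integral_normSq_entry_matGaussian (m n : ℕ) (i : Fin m) (j : Fin n) :
    ∫ Q, Complex.normSq (Q i j) ∂matGaussian m n = 1 := by
  have h := measurePreserving_entry_matGaussian m n i j
  rw [← integral_normSq_stdComplexGaussian, ← h.map_eq,
    integral_map h.aemeasurable (by fun_prop)]

/-- Jensen upper bound on the direct-transmission ergodic capacity:
`E[ln det(I + p HᴴH)] ≤ M ln(1 + p N)` for an `N × M` i.i.d. standard complex
Gaussian matrix `H` and transmit power `p ≥ 0`. -/
theorem stmt_10 (M N : ℕ) (hM : 1 ≤ M) (hN : 1 ≤ N) (p : ℝ) (hp : 0 ≤ p) :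
    ∫ Q, Real.log ((1 + (p : ℂ) • ((Matrix.of Q)ᴴ * Matrix.of Q)).det.re) ∂(matGaussian N M)
      ≤ (M : ℝ) * Real.log (1 + p * N) := by
  have hc : 0 < 1 + p * N := by positivity
  by_cases hint : Integrable (fun Q => Real.log
      ((1 + (p : ℂ) • ((Matrix.of Q)ᴴ * Matrix.of Q)).det.re)) (matGaussian N M)
  swap
  · rw [integral_undef hint]
    exact mul_nonneg M.cast_nonneg (Real.log_nonneg (le_add_of_nonneg_right (by positivity)))
  set S : (Fin N → Fin M → ℂ) → ℝ := fun Q => ∑ i, ∑ j, Complex.normSq (Q i j)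
  have hSint : Integrable S (matGaussian N M) :=
    integrable_finsetSum _ fun i _ => integrable_finsetSum _ fun j _ =>
      integrable_normSq_entry_matGaussian N M i j
  have hS : ∫ Q, S Q ∂matGaussian N M = N * M := by
    rw [integral_finsetSum _ fun i _ => integrable_finsetSum _ fun j _ =>
      integrable_normSq_entry_matGaussian N M i j]
    simp_rw [integral_finsetSum _ fun j _ => integrable_normSq_entry_matGaussian N M _ j,
      integral_normSq_entry_matGaussian]
    simp
  have hbound : Integrable (fun Q => M * Real.log (1 + p * N) - M + M / (1 + p * N)
      + p / (1 + p * N) * S Q) (matGaussian N M) :=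
    (integrable_const _).add (hSint.const_mul _)
  calc _ ≤ ∫ Q, (M * Real.log (1 + p * N) - M + M / (1 + p * N)
        + p / (1 + p * N) * S Q) ∂matGaussian N M := by
        refine integral_mono hint hbound fun Q => ?_
        have h := (posDef_one_add_smul_conjTranspose_mul_self (Matrix.of Q) hp).log_re_det_le hc
        rw [re_trace_one_add_smul_conjTranspose_mul_self, Fintype.card_fin] at h
        refine h.trans_eq ?_
        simp only [S, Matrix.of_apply]
        ring
    _ = M * Real.log (1 + p * N) := by
        rw [integral_add (integrable_const _) (hSint.const_mul _), integral_const_mul, hS]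
        simp only [integral_const, probReal_univ, one_smul]
        field_simp
        ring
end

section
/- (Lemma 1: permutation invariance of the Rayleigh product ergodic capacity) Let μ_ℂ be the standard complex Gaussian measure on ℂ, i.e., the pushforward of the product measure (gaussianReal 0 (1/2)) ×ₘ (gaussianReal 0 (1/2)) under the map (x, y) ↦ x + y*I, and for natural numbers m, n let μ_{m×n} be the product measure (Measure.pi) on Matrix (Fin m) (Fin n) ℂ whose entries are i.i.d. with law μ_ℂ. For natural numbers M, K, N ≥ 1 and real q ≥ 0 define C(M, K, N) = ∫∫ Real.log ((1 + q • ((Q2 * Q1)ᴴ * (Q2 * Q1))).det.re) ∂μ_{K×M}(Q1) ∂μ_{N×K}(Q2). Then C(M, K, N) is invariant under every permutation of the triple (M, K, N); in particular C(M, K, N) = C(K, M, N) = C(M, N, K) = C(N, K, M) = C(K, N, M) = C(N, M, K). -/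
open MeasureTheory ProbabilityTheory Matrix

/-- The ergodic capacity (in nats) of the Rayleigh product channel with `M` user antennas,
`K` UAV antennas, `N` base-station antennas, and transmit power `q`:
`C(M,K,N) = E[ln det(I + q (Q2 Q1)ᴴ (Q2 Q1))]`. -/
noncomputable def ergCap (q : ℝ) (M K N : ℕ) : ℝ :=
  ∫ Q2, (∫ Q1, Real.log
      ((1 + (q : ℂ) • ((Matrix.of Q2 * Matrix.of Q1)ᴴ * (Matrix.of Q2 * Matrix.of Q1))).det.re)
    ∂(matGaussian K M)) ∂(matGaussian N K)

instance inst_s11 (m n : ℕ) : IsProbabilityMeasure (matGaussian m n) := by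
  unfold matGaussian; infer_instance

theorem charFunDual_gaussianReal_zero_half (L : StrongDual ℝ ℝ) :
    charFunDual (gaussianReal 0 (1 / 2)) L = Complex.exp (-(1 / 4) * (L 1 : ℂ) ^ 2) := by
  rw [charFunDual_eq_charFun_map_one]
  have : (L : ℝ → ℝ) = fun x => L 1 * x := by
    ext x
    rw [mul_comm, ← smul_eq_mul, ← map_smul]; simp
  rw [this, gaussianReal_map_const_mul, charFun_gaussianReal]
  congr 1
  push_cast
  norm_num
  ring

theorem charFunDual_stdComplexGaussian (L : StrongDual ℝ ℂ) :
    charFunDual stdComplexGaussian L =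
      Complex.exp (-(1 / 4) * ((L 1 : ℂ) ^ 2 + (L Complex.I : ℂ) ^ 2)) := by
  have h : (fun p : ℝ × ℝ => (p.1 : ℂ) + p.2 * Complex.I) =
      (Complex.equivRealProdCLM.symm : ℝ × ℝ →L[ℝ] ℂ) := by
    ext p
    exact (Complex.equivRealProd_symm_apply p).symm
  have h1 : Complex.equivRealProdCLM.symm (1, 0) = 1 := by
    exact (Complex.equivRealProd_symm_apply (1, 0)).trans (by simp)
  have hI : Complex.equivRealProdCLM.symm (0, 1) = Complex.I := by
    exact (Complex.equivRealProd_symm_apply (0, 1)).trans (by simp)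
  unfold stdComplexGaussian
  rw [h, charFunDual_map, charFunDual_prod, charFunDual_gaussianReal_zero_half,
    charFunDual_gaussianReal_zero_half, ← Complex.exp_add, mul_add]
  simp [h1, hI]

theorem charFunDual_matGaussian {m n : ℕ} (L : StrongDual ℝ (Fin m → Fin n → ℂ)) :
    charFunDual (matGaussian m n) L =
      Complex.exp (-(1 / 4) * (∑ i, ∑ j, (L (Pi.single i (Pi.single j 1)) ^ 2 +
        L (Pi.single i (Pi.single j Complex.I)) ^ 2) : ℝ)) := by
  unfold matGaussian
  simp_rw [charFunDual_pi, charFunDual_stdComplexGaussian, ← Complex.exp_sum]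
  push_cast
  simp [Finset.mul_sum]

/-- Every real linear functional on complex matrices is `X ↦ Re tr (C X)` for some `C`. -/
theorem exists_eq_re_trace_mul {m n : ℕ} (L : StrongDual ℝ (Fin m → Fin n → ℂ)) :
    ∃ C : Matrix (Fin n) (Fin m) ℂ, ∀ X, L X = (C * Matrix.of X).trace.re := by
  refine ⟨Matrix.of fun j i => (L (Pi.single i (Pi.single j 1)) : ℂ) -
    L (Pi.single i (Pi.single j Complex.I)) * Complex.I, fun X => ?_⟩
  have hX : X = ∑ i, ∑ j, ((X i j).re • (Pi.single i (Pi.single j 1) : Fin m → Fin n → ℂ) +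
      (X i j).im • (Pi.single i (Pi.single j Complex.I) : Fin m → Fin n → ℂ)) := by
    have hz (z : ℂ) : z.re • (1 : ℂ) + z.im • Complex.I = z := by simp
    simp_rw [← Pi.single_smul, ← Pi.single_add, hz]
    conv_lhs => rw [← Finset.univ_sum_single X]
    refine Finset.sum_congr rfl fun i _ => ?_
    conv_lhs => rw [← Finset.univ_sum_single (X i)]
    exact map_sum (AddMonoidHom.single (fun _ : Fin m => Fin n → ℂ) i) _ _
  conv_lhs => rw [hX]
  simp only [map_sum, map_add, map_smul, smul_eq_mul, Matrix.trace, Matrix.diag_apply,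
    Matrix.mul_apply, Matrix.of_apply, Complex.re_sum]
  rw [Finset.sum_comm]
  refine Finset.sum_congr rfl fun j _ => Finset.sum_congr rfl fun i _ => ?_
  simp
  ring

theorem charFunDual_matGaussian_eq_exp_trace {m n : ℕ} (L : StrongDual ℝ (Fin m → Fin n → ℂ))
    (C : Matrix (Fin n) (Fin m) ℂ) (hC : ∀ X, L X = (C * Matrix.of X).trace.re) :
    charFunDual (matGaussian m n) L = Complex.exp (-(1 / 4) * ((C * Cᴴ).trace.re : ℝ)) := by
  have key (i : Fin m) (j : Fin n) (z : ℂ) :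
      L (Pi.single i (Pi.single j z)) = (C j i * z).re := by
    have : (Matrix.of (Pi.single i (Pi.single j z)) : Matrix (Fin m) (Fin n) ℂ) =
        Matrix.single i j z := by
      ext a b
      simp [Pi.single_apply, Matrix.single_apply, ite_apply, ite_and, eq_comm]
    rw [hC, this, Matrix.trace_mul_single]
    rfl
  rw [charFunDual_matGaussian]
  congr 3
  simp only [key, Matrix.trace, Matrix.diag_apply, Matrix.mul_apply, Complex.re_sum]
  rw [Finset.sum_comm]
  refine Finset.sum_congr rfl fun j _ => Finset.sum_congr rfl fun i _ => ?_
  simp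
  ring

/-- The law of `A * X`, for `X` a Gaussian matrix, depends on `A` only through `A * Aᴴ`. -/
theorem map_mul_matGaussian_eq {k l m n : ℕ} (A : Matrix (Fin n) (Fin k) ℂ)
    (B : Matrix (Fin n) (Fin l) ℂ) (h : A * Aᴴ = B * Bᴴ) :
    (matGaussian k m).map (fun X => Matrix.of.symm (A * Matrix.of X)) =
      (matGaussian l m).map (fun X => Matrix.of.symm (B * Matrix.of X)) := by
  have key {p : ℕ} (D : Matrix (Fin n) (Fin p) ℂ) :
      ∃ T : (Fin p → Fin m → ℂ) →L[ℝ] (Fin n → Fin m → ℂ),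
        (T : _ → _) = fun X => Matrix.of.symm (D * Matrix.of X) := by
    refine ⟨LinearMap.toContinuousLinearMap
      { toFun := fun X => Matrix.of.symm (D * Matrix.of X)
        map_add' := fun X Y => Matrix.mul_add D (Matrix.of X) (Matrix.of Y)
        map_smul' := fun c X => Matrix.mul_smul D c (Matrix.of X) }, rfl⟩
  obtain ⟨S, hS⟩ := key A
  obtain ⟨T, hT⟩ := key B
  rw [← hS, ← hT]
  have := Measure.isProbabilityMeasure_map (μ := matGaussian k m) S.continuous.aemeasurable
  have := Measure.isProbabilityMeasure_map (μ := matGaussian l m) T.continuous.aemeasurable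
  refine Measure.ext_of_charFunDual (funext fun L => ?_)
  obtain ⟨C, hC⟩ := exists_eq_re_trace_mul L
  rw [charFunDual_map, charFunDual_map, charFunDual_matGaussian_eq_exp_trace _ (C * A),
    charFunDual_matGaussian_eq_exp_trace _ (C * B)]
  · simp only [Matrix.conjTranspose_mul, Matrix.mul_assoc]
    rw [← Matrix.mul_assoc A, ← Matrix.mul_assoc B, h]
  · intro X
    simp [hT, hC, Matrix.mul_assoc]
  · intro X
    simp [hS, hC, Matrix.mul_assoc]

/-- Conjugate transposition as a homeomorphism between spaces of functions. -/
def conjTransposeHomeomorph (m n : ℕ) : (Fin m → Fin n → ℂ) ≃ₜ (Fin n → Fin m → ℂ) where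
  toFun X j i := star (X i j)
  invFun X j i := star (X i j)
  left_inv X := by simp
  right_inv X := by simp
  continuous_toFun := by fun_prop
  continuous_invFun := by fun_prop

theorem of_conjTransposeHomeomorph {m n : ℕ} (X : Fin m → Fin n → ℂ) :
    Matrix.of (conjTransposeHomeomorph m n X) = (Matrix.of X)ᴴ := rfl

theorem map_conjTranspose_matGaussian (m n : ℕ) :
    (matGaussian m n).map (conjTransposeHomeomorph m n) = matGaussian n m := by
  obtain ⟨T, hT⟩ : ∃ T : (Fin m → Fin n → ℂ) →L[ℝ] (Fin n → Fin m → ℂ),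
      (T : _ → _) = conjTransposeHomeomorph m n := by
    refine ⟨LinearMap.toContinuousLinearMap
      { toFun := conjTransposeHomeomorph m n
        map_add' := fun X Y => by ext; simp [conjTransposeHomeomorph]
        map_smul' := fun c X => by ext; simp [conjTransposeHomeomorph] }, rfl⟩
  rw [← hT]
  have := Measure.isProbabilityMeasure_map (μ := matGaussian m n) T.continuous.aemeasurable
  refine Measure.ext_of_charFunDual (funext fun L => ?_)
  obtain ⟨C, hC⟩ := exists_eq_re_trace_mul L
  rw [charFunDual_map, charFunDual_matGaussian_eq_exp_trace _ Cᴴ,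
    charFunDual_matGaussian_eq_exp_trace _ C hC, Matrix.trace_mul_comm,
    Matrix.conjTranspose_conjTranspose]
  intro X
  rw [ContinuousLinearMap.comp_apply, hC, hT, of_conjTransposeHomeomorph,
    ← Complex.conj_re, starRingEnd_apply, ← Matrix.trace_conjTranspose,
    Matrix.conjTranspose_mul, Matrix.conjTranspose_conjTranspose, Matrix.trace_mul_comm]

theorem integral_comp_conjTranspose {m n : ℕ} (f : (Fin n → Fin m → ℂ) → ℝ) :
    ∫ X, f (conjTransposeHomeomorph m n X) ∂(matGaussian m n) = ∫ X, f X ∂(matGaussian n m) := by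
  rw [← map_conjTranspose_matGaussian m n]
  exact ((conjTransposeHomeomorph m n).measurableEmbedding.integral_map f).symm

/-- The instantaneous capacity `ln det (I + q Aᴴ A)` of the channel matrix `A`. -/
noncomputable def logDetCap {n m : ℕ} (q : ℝ) (A : Matrix (Fin n) (Fin m) ℂ) : ℝ :=
  Real.log ((1 + (q : ℂ) • (Aᴴ * A)).det.re)

theorem logDetCap_conjTranspose {n m : ℕ} (q : ℝ) (A : Matrix (Fin n) (Fin m) ℂ) :
    logDetCap q Aᴴ = logDetCap q A := by
  unfold logDetCap
  rw [Matrix.conjTranspose_conjTranspose, ← Matrix.mul_smul, Matrix.det_one_add_mul_comm,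
    Matrix.smul_mul]

theorem measurable_logDetCap_of_continuous {α : Type*} [TopologicalSpace α] [MeasurableSpace α]
    [OpensMeasurableSpace α] {n m : ℕ} (q : ℝ) {A : α → Matrix (Fin n) (Fin m) ℂ}
    (hA : Continuous A) : Measurable fun x => logDetCap q (A x) := by
  refine Real.measurable_log.comp (Continuous.measurable ?_)
  exact Complex.continuous_re.comp (Continuous.matrix_det (by fun_prop))

open scoped MatrixOrder ComplexOrder in
theorem Matrix.exists_isHermitian_mul_self_eq {n k : ℕ} (A : Matrix (Fin n) (Fin k) ℂ) :
    ∃ B : Matrix (Fin n) (Fin n) ℂ, Bᴴ = B ∧ B * B = A * Aᴴ := by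
  have h := (Matrix.posSemidef_self_mul_conjTranspose A).nonneg
  exact ⟨CFC.sqrt (A * Aᴴ), (CFC.sqrt_nonneg (A * Aᴴ)).isSelfAdjoint,
    CFC.sqrt_mul_sqrt_self _ h⟩

theorem integral_logDetCap_mul_eq {k m n : ℕ} (q : ℝ) (A : Matrix (Fin n) (Fin k) ℂ) :
    ∫ X, logDetCap q (A * Matrix.of X) ∂(matGaussian k m) =
      ∫ X, logDetCap q (Aᴴ * Matrix.of X) ∂(matGaussian n m) := by
  obtain ⟨B, hB, hBA⟩ := Matrix.exists_isHermitian_mul_self_eq A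
  have hc {p : ℕ} (D : Matrix (Fin n) (Fin p) ℂ) :
      ∫ X, logDetCap q (D * Matrix.of X) ∂(matGaussian p m) =
        ∫ Y, logDetCap q (Matrix.of Y)
          ∂((matGaussian p m).map (fun X => Matrix.of.symm (D * Matrix.of X))) := by
    have h1 : Continuous fun X : Fin p → Fin m → ℂ => Matrix.of.symm (D * Matrix.of X) :=
      continuous_const.matrix_mul (continuous_id : Continuous fun X : Fin p → Fin m → ℂ => X)
    have h2 : Measurable fun Y : Fin n → Fin m → ℂ => logDetCap q (Matrix.of Y) :=
      measurable_logDetCap_of_continuous (α := Fin n → Fin m → ℂ) q continuous_id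
    rw [integral_map h1.measurable.aemeasurable h2.aestronglyMeasurable]
    rfl
  rw [hc A, map_mul_matGaussian_eq A B (by rw [hB, hBA]), ← hc B]
  congr 1 with X
  unfold logDetCap
  simp only [Matrix.conjTranspose_mul, Matrix.conjTranspose_conjTranspose, hB, Matrix.mul_assoc]
  rw [← Matrix.mul_assoc B, hBA, Matrix.mul_assoc]

theorem ergCap_eq_integral_logDetCap (q : ℝ) (M K N : ℕ) :
    ergCap q M K N = ∫ Q2, ∫ Q1, logDetCap q (Matrix.of Q2 * Matrix.of Q1)
      ∂(matGaussian K M) ∂(matGaussian N K) := rfl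

theorem ergCap_swap_right (q : ℝ) (M K N : ℕ) : ergCap q M N K = ergCap q M K N := by
  rw [ergCap_eq_integral_logDetCap, ← integral_comp_conjTranspose (m := N) (n := K)]
  simp_rw [of_conjTransposeHomeomorph, ← integral_logDetCap_mul_eq]
  rfl

theorem det_one_add_smul_re_eq_prod {m n : ℕ} (q : ℝ) (A : Matrix (Fin n) (Fin m) ℂ) :
    (1 + (q : ℂ) • (Aᴴ * A)).det.re =
      ∏ i, (1 + q * (Matrix.isHermitian_conjTranspose_mul_self A).eigenvalues i) := by
  set h := Matrix.isHermitian_conjTranspose_mul_self A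
  set U := h.eigenvectorUnitary
  have hs := h.spectral_theorem
  rw [Unitary.conjStarAlgAut_apply] at hs
  have h1 : 1 + (q : ℂ) • (Aᴴ * A) = (U : Matrix _ _ ℂ) *
      (1 + (q : ℂ) • Matrix.diagonal (RCLike.ofReal ∘ h.eigenvalues)) *
        (star U : Matrix _ _ ℂ) := by
    conv_lhs => rw [hs]
    simp [mul_add, add_mul, U]
  rw [h1, Matrix.det_mul_right_comm]
  have h2 : (1 + (q : ℂ) • Matrix.diagonal (RCLike.ofReal ∘ h.eigenvalues)) =
    Matrix.diagonal fun i => ((1 + q * h.eigenvalues i : ℝ) : ℂ) := by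
    ext i j
    by_cases hij : i = j <;> simp [hij]
  rw [h2]
  simp [U]
  rw [← Complex.ofReal_re (∏ i, _)]
  push_cast
  rfl

open scoped ComplexOrder in
theorem logDetCap_nonneg {m n : ℕ} {q : ℝ} (hq : 0 ≤ q) (A : Matrix (Fin n) (Fin m) ℂ) :
    0 ≤ logDetCap q A := by
  unfold logDetCap
  rw [det_one_add_smul_re_eq_prod]
  refine Real.log_nonneg (Finset.one_le_prod fun i _ => ?_)
  exact le_add_of_nonneg_right
    (mul_nonneg hq ((Matrix.posSemidef_conjTranspose_mul_self A).eigenvalues_nonneg i))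

open scoped ComplexOrder in
theorem logDetCap_le {m n : ℕ} {q : ℝ} (hq : 0 ≤ q) (A : Matrix (Fin n) (Fin m) ℂ) :
    logDetCap q A ≤ q * ∑ i, ∑ j, ‖A i j‖ ^ 2 := by
  have hpos i := mul_nonneg hq
    ((Matrix.posSemidef_conjTranspose_mul_self A).eigenvalues_nonneg i)
  have htr : ∑ i, (Matrix.isHermitian_conjTranspose_mul_self A).eigenvalues i =
      ∑ i, ∑ j, ‖A i j‖ ^ 2 := by
    have := congrArg Complex.re (Matrix.isHermitian_conjTranspose_mul_self A).trace_eq_sum_eigenvalues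
    simp only [Matrix.trace, Matrix.diag_apply, Matrix.mul_apply, Matrix.conjTranspose_apply,
      Complex.re_sum] at this
    rw [Finset.sum_comm]
    refine Eq.trans ?_ (this.symm.trans ?_)
    · simp
    · refine Finset.sum_congr rfl fun j _ => Finset.sum_congr rfl fun i _ => ?_
      rw [Complex.star_def, ← Complex.normSq_eq_conj_mul_self, Complex.normSq_eq_norm_sq,
        Complex.ofReal_re]
  unfold logDetCap
  rw [det_one_add_smul_re_eq_prod, Real.log_prod fun i _ => by linarith [hpos i], ← htr,
    Finset.mul_sum]
  exact Finset.sum_le_sum fun i _ =>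
    (Real.log_le_sub_one_of_pos (by linarith [hpos i])).trans (by linarith)

theorem sum_norm_sq_mul_le {k m n : ℕ} (A : Matrix (Fin n) (Fin k) ℂ)
    (B : Matrix (Fin k) (Fin m) ℂ) :
    ∑ i, ∑ j, ‖(A * B) i j‖ ^ 2 ≤ (∑ i, ∑ l, ‖A i l‖ ^ 2) * ∑ l, ∑ j, ‖B l j‖ ^ 2 := by
  rw [Finset.sum_comm (s := Finset.univ (α := Fin k)), Finset.sum_mul_sum]
  refine Finset.sum_le_sum fun i _ => Finset.sum_le_sum fun j _ => ?_
  refine le_trans ?_ (Finset.sum_mul_sq_le_sq_mul_sq _ _ _)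
  gcongr
  rw [Matrix.mul_apply]
  exact (norm_sum_le _ _).trans_eq (by simp)

theorem integrable_norm_sq_stdComplexGaussian :
    Integrable (fun z : ℂ => ‖z‖ ^ 2) stdComplexGaussian := by
  have h2 : Integrable (fun x : ℝ => x ^ 2) (gaussianReal 0 (1 / 2)) :=
    (memLp_id_gaussianReal 2).integrable_sq
  unfold stdComplexGaussian
  rw [integrable_map_measure (by fun_prop) (by fun_prop)]
  refine (h2.comp_fst (gaussianReal 0 (1 / 2)) |>.add
    (h2.comp_snd (gaussianReal 0 (1 / 2)))).congr (.of_forall fun p => ?_)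
  simp [← Complex.normSq_eq_norm_sq, Complex.normSq_apply]
  ring

theorem integrable_sum_norm_sq_matGaussian (m n : ℕ) :
    Integrable (fun X : Fin m → Fin n → ℂ => ∑ i, ∑ j, ‖X i j‖ ^ 2) (matGaussian m n) := by
  refine integrable_finsetSum _ fun i _ => integrable_finsetSum _ fun j _ => ?_
  exact ((measurePreserving_eval (fun _ : Fin m => Measure.pi fun _ : Fin n =>
    stdComplexGaussian) i).integrable_comp_of_integrable
      ((measurePreserving_eval (fun _ : Fin n => stdComplexGaussian) j).integrable_comp_of_integrable
        integrable_norm_sq_stdComplexGaussian))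

theorem integrable_logDetCap_mul {q : ℝ} (hq : 0 ≤ q) (M K N : ℕ) :
    Integrable (Function.uncurry fun (Q2 : Fin N → Fin K → ℂ) (Q1 : Fin K → Fin M → ℂ) =>
      logDetCap q (Matrix.of Q2 * Matrix.of Q1)) ((matGaussian N K).prod (matGaussian K M)) := by
  refine (((integrable_sum_norm_sq_matGaussian N K).mul_prod
    (integrable_sum_norm_sq_matGaussian K M)).const_mul q).mono' ?_ (.of_forall fun p => ?_)
  · refine Measurable.aestronglyMeasurable ?_
    refine measurable_logDetCap_of_continuous q ?_
    exact (continuous_fst : Continuous fun p : (Fin N → Fin K → ℂ) × (Fin K → Fin M → ℂ) =>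
      p.1).matrix_mul continuous_snd
  · rw [Function.uncurry_def, Real.norm_of_nonneg (logDetCap_nonneg hq _)]
    exact (logDetCap_le hq _).trans (mul_le_mul_of_nonneg_left (sum_norm_sq_mul_le _ _) hq)

theorem ergCap_swap_outer {q : ℝ} (hq : 0 ≤ q) (M K N : ℕ) :
    ergCap q N K M = ergCap q M K N := by
  rw [ergCap_eq_integral_logDetCap, ergCap_eq_integral_logDetCap,
    integral_integral_swap (integrable_logDetCap_mul hq M K N),
    ← integral_comp_conjTranspose (m := M) (n := K)]
  congr 1 with P2
  rw [← integral_comp_conjTranspose (m := K) (n := N)]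
  simp_rw [of_conjTransposeHomeomorph, ← Matrix.conjTranspose_mul, logDetCap_conjTranspose]

/-- Lemma 1: the ergodic capacity of the Rayleigh product channel is
invariant under every permutation of the antenna numbers `(M, K, N)`. -/
theorem stmt_11 (M K N : ℕ) (hM : 1 ≤ M) (hK : 1 ≤ K) (hN : 1 ≤ N)
    (q : ℝ) (hq : 0 ≤ q) (σ : Equiv.Perm (Fin 3)) :
    ergCap q (![M, K, N] (σ 0)) (![M, K, N] (σ 1)) (![M, K, N] (σ 2)) = ergCap q M K N := by
  have h1 := ergCap_swap_right q
  have h2 := @ergCap_swap_outer q hq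
  have h3 : ergCap q K M N = ergCap q M K N := by rw [← h2, h1, h2]
  have hσ : ∀ σ : Equiv.Perm (Fin 3),
      (σ 0 = 0 ∧ σ 1 = 1 ∧ σ 2 = 2) ∨ (σ 0 = 0 ∧ σ 1 = 2 ∧ σ 2 = 1) ∨
      (σ 0 = 1 ∧ σ 1 = 0 ∧ σ 2 = 2) ∨ (σ 0 = 1 ∧ σ 1 = 2 ∧ σ 2 = 0) ∨
      (σ 0 = 2 ∧ σ 1 = 0 ∧ σ 2 = 1) ∨ (σ 0 = 2 ∧ σ 1 = 1 ∧ σ 2 = 0) := by decide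
  obtain ⟨a, b, c⟩ | ⟨a, b, c⟩ | ⟨a, b, c⟩ | ⟨a, b, c⟩ | ⟨a, b, c⟩ | ⟨a, b, c⟩ := hσ σ <;>
    rw [a, b, c]
  · rfl
  · exact h1 M K N
  · exact h3
  · exact (h1 K M N).trans h3
  · exact (h1 N K M).trans (h2 M K N)
  · exact h2 M K N
end
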